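/- There exist a constant c > 0 and N ∈ ℕ such that for every n ≥ N, the polyhedron COMB(n) = {x ∈ ℝ^{E(K_n)} : x(δ(H)) + Σ_{i=1}^{k} x(δ(T_i)) ≥ 3k+1 for every comb with handle H and teeth T_1, …, T_k in K_n} has extension complexity xc(COMB(n)) ≥ 2^{c·n}. -/

import Mathlib

open SimpleGraph Finset

attribute [local instance] Classical.propDecidable

/-- The edge set of the complete graph `K_n`: non-diagonal unordered pairs. -/
abbrev KEdge (n : ℕ) := {e : Sym2 (Fin n) // ¬ e.IsDiag}

/-- An edge `e` crosses the vertex set `S` if it has an endpoint in `S`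
and an endpoint outside `S`. -/
def crossing {V : Type*} (S : Finset V) (e : Sym2 V) : Prop :=
  (∃ a ∈ e, a ∈ S) ∧ (∃ a ∈ e, a ∉ S)

/-- `x(δ(S))`: the sum of the coordinates of `x` over the edges of `K_n`
crossing `S`. -/
noncomputable def cutSum {n : ℕ} (S : Finset (Fin n)) (x : KEdge n → ℝ) : ℝ :=
  ∑ e ∈ Finset.univ.filter (fun e : KEdge n => crossing S e.1), x e

/-- A comb with handle `H` and teeth `T 0, …, T (k-1)`. -/
def IsComb {V : Type*} [Fintype V] [DecidableEq V]
    (H : Finset V) {k : ℕ} (T : Fin k → Finset V) : Prop :=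
  3 ≤ k ∧ Odd k ∧
  (∀ i j, i ≠ j → Disjoint (T i) (T j)) ∧
  (∀ i, (H ∩ T i).Nonempty) ∧
  (H \ Finset.univ.biUnion T).Nonempty

/-- An `(h,t)`-uniform comb: every tooth has size `t` and meets the handle
in exactly `h` vertices. -/
def IsUniformComb {V : Type*} [Fintype V] [DecidableEq V] (h t : ℕ)
    (H : Finset V) {k : ℕ} (T : Fin k → Finset V) : Prop :=
  IsComb H T ∧ ∀ i, (T i).card = t ∧ (H ∩ T i).card = h

/-- The extension complexity of `P ⊆ ℝ^ι`: the least number of facets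
(inequalities) of a polyhedron `{x : Ax ≤ b}` projecting linearly onto `P`. -/
noncomputable def xc {ι : Type*} [Fintype ι] (P : Set (ι → ℝ)) : ℕ :=
  sInf {k | ∃ (m : ℕ) (A : Matrix (Fin k) (Fin m) ℝ) (b : Fin k → ℝ)
      (π : (Fin m → ℝ) →ₗ[ℝ] (ι → ℝ)),
      π '' {x | A.mulVec x ≤ b} = P}

/-- The polytope defined by all comb inequalities for `TSP_n`. -/
noncomputable def combPolytope (n : ℕ) : Set (KEdge n → ℝ) :=
  {x | ∀ (H : Finset (Fin n)) (k : ℕ) (T : Fin k → Finset (Fin n)),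
      IsComb H T → (3 * k + 1 : ℝ) ≤ cutSum H x + ∑ i, cutSum (T i) x}

/-! ### Unique disjointness: the rectangle bound -/

section Rect
variable {α : Type*}

/-- number of disjoint pairs of subsets of `U` in the rectangle `A × B` -/
noncomputable def djCount (U : Finset α) (A B : Finset α → Prop) : ℕ :=
  ∑ a ∈ U.powerset, ∑ b ∈ U.powerset, if A a ∧ B b ∧ Disjoint a b then 1 else 0

lemma djCount_insert (U : Finset α) (x : α) (hx : x ∉ U) (A B : Finset α → Prop) :
    djCount (insert x U) A B = ∑ a ∈ U.powerset, ∑ b ∈ U.powerset,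
      ((if A a ∧ B b ∧ Disjoint a b then 1 else 0)
        + (if A a ∧ B (insert x b) ∧ Disjoint a b then 1 else 0)
        + (if A (insert x a) ∧ B b ∧ Disjoint a b then 1 else 0)) := by
  unfold djCount
  rw [Finset.sum_powerset_insert hx, ← Finset.sum_add_distrib]
  refine Finset.sum_congr rfl fun a ha => ?_
  rw [Finset.sum_powerset_insert hx, Finset.sum_powerset_insert hx, ← Finset.sum_add_distrib,
    ← Finset.sum_add_distrib, ← Finset.sum_add_distrib]
  refine Finset.sum_congr rfl fun b hb => ?_
  have hxa : x ∉ a := fun h => hx (Finset.mem_powerset.1 ha h)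
  have hxb : x ∉ b := fun h => hx (Finset.mem_powerset.1 hb h)
  have e1 : Disjoint a (insert x b) ↔ Disjoint a b := by
    simp [Finset.disjoint_insert_right, hxa]
  have e2 : Disjoint (insert x a) b ↔ Disjoint a b := by
    simp [Finset.disjoint_insert_left, hxb]
  have e3 : ¬ Disjoint (insert x a) (insert x b) := by
    simp [Finset.disjoint_insert_left]
  simp only [e1, e2, e3, and_false, if_false, add_zero]

lemma djCount_total (U : Finset α) : djCount U (fun _ => True) (fun _ => True) = 3 ^ U.card := by
  induction U using Finset.induction_on with
  | empty => simp [djCount]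
  | insert x U hx ih =>
    rw [djCount_insert U x hx, Finset.card_insert_of_notMem hx, pow_succ, ← ih]
    unfold djCount
    simp only [Finset.sum_add_distrib]
    ring

lemma djCount_rect (U : Finset α) : ∀ (A B : Finset α → Prop),
    (∀ a b, a ⊆ U → b ⊆ U → A a → B b → (a ∩ b).card ≠ 1) →
    djCount U A B ≤ 2 ^ U.card := by
  induction U using Finset.induction_on with
  | empty =>
    intro A B _
    simp only [djCount, Finset.powerset_empty, Finset.sum_singleton, Finset.card_empty, pow_zero]
    split_ifs <;> simp
  | insert x U hx ih =>
    intro A B h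
    have h1 := ih (fun a => A a ∨ A (insert x a)) B (by
      intro a b ha hb hA hB
      rcases hA with hA | hA
      · exact h a b (ha.trans (Finset.subset_insert _ _)) (hb.trans (Finset.subset_insert _ _)) hA hB
      · have := h _ b (Finset.insert_subset_insert x ha) (hb.trans (Finset.subset_insert _ _)) hA hB
        rwa [Finset.insert_inter_of_notMem (fun hh => hx (hb hh))] at this)
    have h2 := ih A (fun b => B b ∨ B (insert x b)) (by
      intro a b ha hb hA hB
      rcases hB with hB | hB
      · exact h a b (ha.trans (Finset.subset_insert _ _)) (hb.trans (Finset.subset_insert _ _)) hA hB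
      · have := h a _ (ha.trans (Finset.subset_insert _ _)) (Finset.insert_subset_insert x hb) hA hB
        rwa [Finset.inter_insert_of_notMem (fun hh => hx (ha hh))] at this)
    rw [djCount_insert U x hx, Finset.card_insert_of_notMem hx, pow_succ]
    calc _ ≤ djCount U (fun a => A a ∨ A (insert x a)) B
          + djCount U A (fun b => B b ∨ B (insert x b)) := by
          unfold djCount
          rw [← Finset.sum_add_distrib]
          refine Finset.sum_le_sum fun a ha => ?_
          rw [← Finset.sum_add_distrib]
          refine Finset.sum_le_sum fun b hb => ?_
          by_cases hd : Disjoint a b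
          · have ha' := Finset.mem_powerset.1 ha
            have hb' := Finset.mem_powerset.1 hb
            have key : ¬ (A (insert x a) ∧ B (insert x b)) := by
              rintro ⟨hA, hB⟩
              refine h _ _ (Finset.insert_subset_insert x ha') (Finset.insert_subset_insert x hb')
                hA hB ?_
              rw [← Finset.insert_inter_distrib, Finset.disjoint_iff_inter_eq_empty.1 hd]
              simp
            clear h h1 h2 ih ha hb ha' hb' hx
            by_cases c1 : A a <;> by_cases c2 : A (insert x a) <;> by_cases c3 : B b <;>
              by_cases c4 : B (insert x b) <;> simp_all
          · simp [hd]
      _ ≤ _ := by omega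

/-- rectangle cover bound -/
lemma cover_bound {m k : ℕ} (I J : Fin k → Finset (Fin m) → Prop)
    (h0 : ∀ i a b, I i a → J i b → (a ∩ b).card ≠ 1)
    (h1 : ∀ a b : Finset (Fin m), a.Nonempty → Disjoint a b → ∃ i, I i a ∧ J i b) :
    3 ^ m ≤ (k + 1) * 2 ^ m := by
  have ht := djCount_total (Finset.univ : Finset (Fin m))
  have hr : ∀ i, djCount (Finset.univ : Finset (Fin m)) (I i) (J i) ≤ 2 ^ m := by
    intro i
    have := djCount_rect (Finset.univ : Finset (Fin m)) (I i) (J i)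
      (fun a b _ _ h1 h2 => by convert h0 i a b h1 h2)
    simpa using this
  have he : djCount (Finset.univ : Finset (Fin m)) (fun a => a = ∅) (fun _ => True) ≤ 2 ^ m := by
    have := djCount_rect (Finset.univ : Finset (Fin m)) (fun a => a = ∅) (fun _ => True)
      (by rintro a b _ _ rfl _; simp)
    simpa using this
  simp only [Finset.card_univ, Fintype.card_fin] at ht
  rw [← ht]
  calc _ ≤ ∑ i, djCount (Finset.univ : Finset (Fin m)) (I i) (J i)
        + djCount (Finset.univ : Finset (Fin m)) (fun a => a = ∅) (fun _ => True) := by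
        unfold djCount
        rw [Finset.sum_comm (s := (Finset.univ : Finset (Fin k))), ← Finset.sum_add_distrib]
        refine Finset.sum_le_sum fun a _ => ?_
        rw [Finset.sum_comm (s := (Finset.univ : Finset (Fin k))), ← Finset.sum_add_distrib]
        refine Finset.sum_le_sum fun b _ => ?_
        by_cases hd : Disjoint a b
        · by_cases hn : a = ∅
          · simp [hn]
          · obtain ⟨i, hi⟩ := h1 a b (Finset.nonempty_iff_ne_empty.2 hn) hd
            have : (if I i a ∧ J i b ∧ Disjoint a b then 1 else 0) ≤
                ∑ i, if I i a ∧ J i b ∧ Disjoint a b then 1 else 0 :=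
              Finset.single_le_sum (f := fun i => if I i a ∧ J i b ∧ Disjoint a b then 1 else 0)
                (fun _ _ => Nat.zero_le _) (Finset.mem_univ i)
            simp only [hi, hd, and_self, if_true] at this
            simp only [hd, and_true, if_true, true_and]
            simp only [hd, and_true] at this
            omega
        · simp [hd]
    _ ≤ ∑ _i : Fin k, 2 ^ m + 2 ^ m := Nat.add_le_add (Finset.sum_le_sum fun i _ => hr i) he
    _ = _ := by simp; ring
end Rect

/-! ### Faces -/

lemma face_cover {k d : ℕ} {J : Type*} [Fintype J] (A : Matrix (Fin k) (Fin d) ℝ) (c : Fin k → ℝ)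
    (ψ : (Fin d → ℝ) →ₗ[ℝ] ℝ) (δ : ℝ) (hψ : ∀ y, A.mulVec y ≤ c → δ ≤ ψ y)
    (y : J → Fin d → ℝ) (hy : ∀ j, A.mulVec (y j) ≤ c) (j0 : J) (hj0 : ψ (y j0) = δ)
    (j : J) (hj : δ < ψ (y j)) :
    ∃ i, (∀ j', ψ (y j') = δ → A.mulVec (y j') i = c i) ∧ A.mulVec (y j) i < c i := by
  by_contra hcon
  push Not at hcon
  set Tt : Finset J := Finset.univ.filter (fun j' => ψ (y j') = δ) with hT
  have hTm : ∀ j', j' ∈ Tt ↔ ψ (y j') = δ := fun j' =>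
    Finset.mem_filter.trans (by simp)
  have hpos : (0 : ℝ) < Tt.card := by
    have : 0 < Tt.card := Finset.card_pos.2 ⟨j0, (hTm _).2 hj0⟩
    exact_mod_cast this
  set w : Fin d → ℝ := (Tt.card : ℝ)⁻¹ • ∑ j' ∈ Tt, y j' with hw
  have hψw : ψ w = δ := by
    rw [hw, map_smul, map_sum, Finset.sum_congr rfl (fun j' hj' => (hTm j').1 hj')]
    simp [hpos.ne']
  have hAw : ∀ i, A.mulVec w i = (Tt.card : ℝ)⁻¹ * ∑ j' ∈ Tt, A.mulVec (y j') i := by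
    intro i
    rw [hw, Matrix.mulVec_smul, Matrix.mulVec_sum]
    simp
  clear_value w
  clear_value Tt
  have hci : ∀ i, c i = (Tt.card : ℝ)⁻¹ * ∑ j' ∈ Tt, c i := by
    intro i; simp [hpos.ne']
  have hAwle : ∀ i, A.mulVec w i ≤ c i := by
    intro i
    rw [hAw, hci i]
    exact mul_le_mul_of_nonneg_left (Finset.sum_le_sum fun j' _ => hy j' i) (inv_pos.2 hpos).le
  have hlt : ∀ i, A.mulVec (y j) i < c i → A.mulVec w i < c i := by
    intro i hi
    have : ∃ j', ψ (y j') = δ ∧ A.mulVec (y j') i ≠ c i := by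
      by_contra hno
      push Not at hno
      exact absurd (hcon i hno) (not_le.2 hi)
    obtain ⟨j', h1, h2⟩ := this
    rw [hAw, hci i]
    refine mul_lt_mul_of_pos_left ?_ (inv_pos.2 hpos)
    exact Finset.sum_lt_sum (fun j' _ => hy j' i) ⟨j', (hTm _).2 h1, lt_of_le_of_ne (hy j' i) h2⟩
  have hev : ∀ i, ∀ᶠ ε in nhdsWithin (0 : ℝ) (Set.Ioi 0),
      A.mulVec w i + ε * (A.mulVec w i - A.mulVec (y j) i) ≤ c i := by
    intro i
    by_cases hi : A.mulVec (y j) i < c i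
    · have h1 := hlt i hi
      have : Filter.Tendsto (fun ε : ℝ => A.mulVec w i + ε * (A.mulVec w i - A.mulVec (y j) i))
          (nhdsWithin 0 (Set.Ioi 0)) (nhds (A.mulVec w i)) := by
        have hc : Continuous (fun ε : ℝ => A.mulVec w i + ε * (A.mulVec w i - A.mulVec (y j) i)) := by
          fun_prop
        have := hc.tendsto 0
        simp only [zero_mul, add_zero] at this
        exact this.mono_left nhdsWithin_le_nhds
      exact (this.eventually_lt_const h1).mono fun _ h => h.le
    · filter_upwards [self_mem_nhdsWithin] with ε hε
      have h2 : A.mulVec (y j) i = c i := le_antisymm (hy j i) (not_lt.1 hi)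
      have h3 := hAwle i
      have hε' : (0 : ℝ) < ε := hε
      rw [h2]
      nlinarith
  obtain ⟨ε, hε, hε0⟩ := ((Filter.eventually_all.2 hev).and self_mem_nhdsWithin).exists
  have hε0' : (0 : ℝ) < ε := hε0
  have := hψ (w + ε • (w - y j)) (by
    intro i
    have := hε i
    simpa [Matrix.mulVec_add, Matrix.mulVec_smul, Matrix.mulVec_sub] using this)
  rw [map_add, map_smul, map_sub, hψw, smul_eq_mul] at this
  nlinarith

/-! ### cut sums -/

section Cut
variable {n : ℕ}

lemma cutSum_add (S : Finset (Fin n)) (x y : KEdge n → ℝ) :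
    cutSum S (x + y) = cutSum S x + cutSum S y := by
  simp [cutSum, Finset.sum_add_distrib]

lemma cutSum_sub (S : Finset (Fin n)) (x y : KEdge n → ℝ) :
    cutSum S (x - y) = cutSum S x - cutSum S y := by
  simp [cutSum, Finset.sum_sub_distrib]

lemma cutSum_smul (S : Finset (Fin n)) (c : ℝ) (x : KEdge n → ℝ) :
    cutSum S (c • x) = c * cutSum S x := by
  simp [cutSum, Finset.mul_sum]

noncomputable def cutL (S : Finset (Fin n)) : (KEdge n → ℝ) →ₗ[ℝ] ℝ where
  toFun := cutSum S
  map_add' := cutSum_add S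
  map_smul' := cutSum_smul S

noncomputable def spin (S : Finset (Fin n)) (v : Fin n) : ℝ := if v ∈ S then 1 else -1

noncomputable def ev (k σ : Fin n → ℝ) : ℝ := ∑ v, k v * σ v

noncomputable def formPt (k l : Fin n → ℝ) : KEdge n → ℝ := fun e =>
  Sym2.lift ⟨fun u v => -2 * (k u * l v + l u * k v), by intros; ring⟩ e.1

lemma cutSum_formPt (S : Finset (Fin n)) (k l : Fin n → ℝ) :
    cutSum S (formPt k l) = ev k (spin S) * ev l (spin S)
      - ev k (fun _ => 1) * ev l (fun _ => 1) := by
  have h1 : cutSum S (formPt k l) =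
      ∑ p ∈ S ×ˢ Sᶜ, -2 * (k p.1 * l p.2 + l p.1 * k p.2) := by
    unfold cutSum
    symm
    refine Finset.sum_bij (fun p hp => (⟨s(p.1, p.2), by
      simp only [Finset.mem_product, Finset.mem_compl] at hp
      rw [Sym2.mk_isDiag_iff]
      intro h
      exact hp.2 (h ▸ hp.1)⟩ : KEdge n)) ?_ ?_ ?_ ?_
    · intro p hp
      simp only [Finset.mem_product, Finset.mem_compl] at hp
      refine Finset.mem_filter.2 ⟨Finset.mem_univ _, ?_⟩
      exact ⟨⟨p.1, by simp, hp.1⟩, ⟨p.2, by simp, hp.2⟩⟩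
    · rintro ⟨a, b⟩ hp ⟨c, d⟩ hq h
      simp only [Finset.mem_product, Finset.mem_compl] at hp hq
      simp only [Subtype.mk.injEq, Sym2.eq_iff] at h
      rcases h with ⟨rfl, rfl⟩ | ⟨rfl, rfl⟩
      · rfl
      · exact absurd hp.1 hq.2
    · rintro ⟨e, he⟩ h
      obtain ⟨⟨a, ha, haS⟩, ⟨b, hb, hbS⟩⟩ := (Finset.mem_filter.1 h).2
      refine ⟨(a, b), by simp [haS, hbS], ?_⟩
      have hab : a ≠ b := fun h => hbS (h ▸ haS)
      simp only [Subtype.mk.injEq]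
      exact ((Sym2.mem_and_mem_iff hab).1 ⟨ha, hb⟩).symm
    · intro p hp
      simp [formPt]
  have h2 : ∀ f : Fin n → ℝ, ev f (spin S) = ∑ v ∈ S, f v - ∑ v ∈ Sᶜ, f v := by
    intro f
    unfold ev
    rw [← Finset.sum_add_sum_compl S, sub_eq_add_neg, ← Finset.sum_neg_distrib]
    congr 1
    · refine Finset.sum_congr rfl fun v hv => ?_
      simp [spin, hv]
    · refine Finset.sum_congr rfl fun v hv => ?_
      simp [spin, Finset.mem_compl.1 hv]
  have h3 : ∀ f : Fin n → ℝ, ev f (fun _ => 1) = ∑ v ∈ S, f v + ∑ v ∈ Sᶜ, f v := by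
    intro f
    unfold ev
    rw [Finset.sum_add_sum_compl S]
    simp
  rw [h1, h2, h2, h3, h3, ← Finset.mul_sum, Finset.sum_add_distrib, Finset.sum_product,
    Finset.sum_product]
  simp only [← Finset.mul_sum, ← Finset.sum_mul]
  ring

lemma ev_add (k l σ : Fin n → ℝ) : ev (k + l) σ = ev k σ + ev l σ := by
  simp [ev, add_mul, Finset.sum_add_distrib]
lemma ev_sub (k l σ : Fin n → ℝ) : ev (k - l) σ = ev k σ - ev l σ := by
  simp [ev, sub_mul, Finset.sum_sub_distrib]
lemma ev_smul (c : ℝ) (k σ : Fin n → ℝ) : ev (c • k) σ = c * ev k σ := by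
  simp [ev, Finset.mul_sum, mul_assoc]
lemma ev_sum {ι : Type*} (s : Finset ι) (k : ι → Fin n → ℝ) (σ : Fin n → ℝ) :
    ev (∑ i ∈ s, k i) σ = ∑ i ∈ s, ev (k i) σ := by
  simp only [ev, Finset.sum_apply, Finset.sum_mul]
  rw [Finset.sum_comm]
noncomputable def sg (v : Fin n) : Fin n → ℝ := fun u => if u = v then 1 else 0
lemma ev_sg (v : Fin n) (σ : Fin n → ℝ) : ev (sg v) σ = σ v := by
  simp [ev, sg]

end Cut

/-! ### polyhedrality -/

lemma xc_set_nonempty (n : ℕ) : {k | ∃ (m : ℕ) (A : Matrix (Fin k) (Fin m) ℝ) (b : Fin k → ℝ)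
      (π : (Fin m → ℝ) →ₗ[ℝ] (KEdge n → ℝ)),
      π '' {x | A.mulVec x ≤ b} = combPolytope n}.Nonempty := by
  let I := {c : (Σ k : Fin (n + 1), Finset (Fin n) × (Fin k → Finset (Fin n))) //
    IsComb c.2.1 c.2.2}
  let E := Fintype.equivFin (KEdge n)
  let F := Fintype.equivFin I
  let π : (Fin (Fintype.card (KEdge n)) → ℝ) →ₗ[ℝ] (KEdge n → ℝ) := LinearMap.funLeft ℝ ℝ E
  let Φ : (KEdge n → ℝ) →ₗ[ℝ] (Fin (Fintype.card I) → ℝ) :=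
    LinearMap.pi fun i => -(cutL (F.symm i).1.2.1 + ∑ j, cutL ((F.symm i).1.2.2 j))
  refine ⟨Fintype.card I, Fintype.card (KEdge n), LinearMap.toMatrix' (Φ ∘ₗ π),
    fun i => -(3 * ((F.symm i).1.1 : ℕ) + 1 : ℝ), π, ?_⟩
  have hΦ : ∀ x i, Φ x i = -(cutSum (F.symm i).1.2.1 x + ∑ j, cutSum ((F.symm i).1.2.2 j) x) := by
    intro x i
    simp [Φ, cutL]
  ext x
  constructor
  · rintro ⟨y, hy, rfl⟩
    intro H k T hc
    have hk : k < n + 1 := by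
      have hne : ∀ i, ∃ v, v ∈ T i := fun i => by
        obtain ⟨v, hv⟩ := hc.2.2.2.1 i
        exact ⟨v, (Finset.mem_inter.1 hv).2⟩
      choose v hv using hne
      have hinj : Function.Injective v := by
        intro i j hij
        by_contra hne
        exact Finset.disjoint_left.1 (hc.2.2.1 i j hne) (hv i) (hij ▸ hv j)
      have := Fintype.card_le_of_injective v hinj
      simp at this
      omega
    have := hy (F ⟨⟨⟨k, hk⟩, (H, T)⟩, hc⟩)
    rw [LinearMap.toMatrix'_mulVec, LinearMap.comp_apply, hΦ] at this
    have gen : ∀ c c' : I, c = c' → ∀ z : KEdge n → ℝ,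
        -(cutSum c.1.2.1 z + ∑ j, cutSum (c.1.2.2 j) z) ≤ -(3 * (c.1.1 : ℕ) + 1 : ℝ) →
        -(cutSum c'.1.2.1 z + ∑ j, cutSum (c'.1.2.2 j) z) ≤ -(3 * (c'.1.1 : ℕ) + 1 : ℝ) := by
      rintro c _ rfl z h
      exact h
    have := gen _ _ (F.symm_apply_apply _) _ this
    simp only at this
    linarith
  · intro hx
    refine ⟨x ∘ E.symm, ?_, ?_⟩
    · intro i
      have hp : π (x ∘ E.symm) = x := by
        ext e; simp [π, LinearMap.funLeft_apply]
      rw [LinearMap.toMatrix'_mulVec, LinearMap.comp_apply, hΦ, hp]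
      have := hx _ _ _ (F.symm i).2
      linarith
    · ext e; simp [π, LinearMap.funLeft_apply]

/-! ### The numerical heart of the construction -/

/-- value of the cut function of the constructed points in terms of spins -/
noncomputable def FF (m β X Y r0 r1 r2 s0 s1 s2 : ℝ) : ℝ :=
  (((1 - β / 2) * (1 / 2 * (r0 - s0)) - 1 / 2 * Y) ^ 2 - β ^ 2 / 4)
  - (m ^ 2 + 10) * (X * (1 / 2 * (r0 + s0) + 1 / 2 * (r1 + s1) + 1 / 2 * (r2 + s2)) - 3 * m)
  + (100 + 10 * ((m ^ 2 + 10) * m) + 10 * m ^ 2) * ((1 / 2 * (r0 - s0)) ^ 2 +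
      (1 / 2 * (r1 - s1)) ^ 2 + (1 / 2 * (r2 - s2)) ^ 2)
  - (5 / 6 - (m ^ 2 + 10) * m / 2) * ((1 / 2 * (r0 + s0)) * (1 / 2 * (r1 + s1))
      + (1 / 2 * (r0 + s0)) * (1 / 2 * (r2 + s2)) + (1 / 2 * (r1 + s1)) * (1 / 2 * (r2 + s2)) - 3)
  - ((100 + 10 * ((m ^ 2 + 10) * m) + 10 * m ^ 2) + (5 / 6 - (m ^ 2 + 10) * m / 2)
      + (m ^ 2 + 10) * m - β ^ 2 / 12) *
      ((1 / 2 * (r0 - s0)) * (1 / 2 * (r1 - s1))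
      + (1 / 2 * (r0 - s0)) * (1 / 2 * (r2 - s2)) + (1 / 2 * (r1 - s1)) * (1 / 2 * (r2 - s2)))

set_option maxHeartbeats 4000000 in
lemma FF_class (m β X Y r0 r1 r2 s0 s1 s2 : ℝ) (hm1 : 1 ≤ m) (hβ0 : 0 ≤ β) (hβm : β ≤ m)
    (hr0 : r0 = 1 ∨ r0 = -1) (hr1 : r1 = 1 ∨ r1 = -1) (hr2 : r2 = 1 ∨ r2 = -1)
    (hs0 : s0 = 1 ∨ s0 = -1) (hs1 : s1 = 1 ∨ s1 = -1) (hs2 : s2 = 1 ∨ s2 = -1)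
    (hX : (X = m ∧ Y = β) ∨ (X = -m ∧ Y = -β) ∨ (-m + 2 ≤ X ∧ X ≤ m - 2)) :
    (FF m β X Y r0 r1 r2 s0 s1 s2 = 0 ∧ ((X = m ∧ (r0 = 1 ∧ r1 = 1 ∧ r2 = 1) ∧
        (s0 = 1 ∧ s1 = 1 ∧ s2 = 1)) ∨ (X = -m ∧ (r0 = -1 ∧ r1 = -1 ∧ r2 = -1) ∧
        (s0 = -1 ∧ s1 = -1 ∧ s2 = -1)))) ∨
    10 ≤ FF m β X Y r0 r1 r2 s0 s1 s2 ∨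
    (10 / 3 ≤ FF m β X Y r0 r1 r2 s0 s1 s2 ∧
      ((r0 = 1 ∧ s0 = 1) ∨ (r1 = 1 ∧ s1 = 1) ∨ (r2 = 1 ∧ s2 = 1))) ∨
    (0 ≤ FF m β X Y r0 r1 r2 s0 s1 s2 ∧ (s0 = -r0 ∧ s1 = -r1 ∧ s2 = -r2)) := by
  have hm : 0 ≤ m := hβ0.trans hβm
  set z := ((1 - β / 2) * (1 / 2 * (r0 - s0)) - 1 / 2 * Y) ^ 2 with hz
  have hz0 : 0 ≤ z := sq_nonneg _
  set K := β ^ 2 / 4 with hK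
  have hK0 : 0 ≤ K := by positivity
  have hKm : 4 * K ≤ m ^ 2 := by rw [hK]; nlinarith
  have hzK : r0 = s0 → (X = m ∧ Y = β) ∨ (X = -m ∧ Y = -β) → z = K := by
    rintro h (⟨_, h2⟩ | ⟨_, h2⟩) <;> rw [hz, hK, h, h2] <;> ring
  have hQX : (X = m ∧ (m ^ 2 + 10) * X = (m ^ 2 + 10) * m) ∨
      (X = -m ∧ (m ^ 2 + 10) * X = -((m ^ 2 + 10) * m)) ∨
      (-((m ^ 2 + 10) * m) + 2 * (m ^ 2 + 10) ≤ (m ^ 2 + 10) * X ∧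
        (m ^ 2 + 10) * X ≤ (m ^ 2 + 10) * m - 2 * (m ^ 2 + 10)) := by
    have hQ : 0 ≤ m ^ 2 + 10 := by positivity
    rcases hX with ⟨h, _⟩ | ⟨h, _⟩ | ⟨h1, h2⟩
    · left; rw [h]; simp
    · right; left; rw [h]; constructor <;> ring
    · right; right; constructor <;> nlinarith
  have hzK' : r0 = s0 → (X = m ∨ X = -m) → z = K := by
    intro h h'
    rcases hX with h1 | h1 | h1
    · exact hzK h (Or.inl h1)
    · exact hzK h (Or.inr h1)
    · rcases h' with h' | h' <;> exfalso <;> linarith [h1.1, h1.2]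
  have hq0 : m ^ 2 + 10 ≤ (m ^ 2 + 10) * m := by
    nlinarith [sq_nonneg m]
  have hFF : FF m β X Y r0 r1 r2 s0 s1 s2 = (z - K)
      - (((m ^ 2 + 10) * X) * (1 / 2 * (r0 + s0) + 1 / 2 * (r1 + s1) + 1 / 2 * (r2 + s2))
        - 3 * ((m ^ 2 + 10) * m))
      + (100 + 10 * ((m ^ 2 + 10) * m) + 10 * m ^ 2) * ((1 / 2 * (r0 - s0)) ^ 2 +
      (1 / 2 * (r1 - s1)) ^ 2 + (1 / 2 * (r2 - s2)) ^ 2)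
      - (5 / 6 - ((m ^ 2 + 10) * m) / 2) * ((1 / 2 * (r0 + s0)) * (1 / 2 * (r1 + s1))
      + (1 / 2 * (r0 + s0)) * (1 / 2 * (r2 + s2)) + (1 / 2 * (r1 + s1)) * (1 / 2 * (r2 + s2)) - 3)
      - ((100 + 10 * ((m ^ 2 + 10) * m) + 10 * m ^ 2) + (5 / 6 - ((m ^ 2 + 10) * m) / 2)
      + ((m ^ 2 + 10) * m) - K / 3) *
      ((1 / 2 * (r0 - s0)) * (1 / 2 * (r1 - s1))
      + (1 / 2 * (r0 - s0)) * (1 / 2 * (r2 - s2)) + (1 / 2 * (r1 - s1)) * (1 / 2 * (r2 - s2))) := by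
    rw [hz, hK]; unfold FF; ring
  generalize FF m β X Y r0 r1 r2 s0 s1 s2 = F at *
  clear hzK hX hz hK
  clear_value z K
  generalize (m ^ 2 + 10) * X = QX at *
  generalize (m ^ 2 + 10) * m = q at *
  have hM0 : 0 ≤ m ^ 2 := by positivity
  generalize m ^ 2 = M at *
  clear hβ0 hβm
  have n1 : ¬ ((1 : ℝ) = -1) := by norm_num
  have n2 : ¬ ((-1 : ℝ) = 1) := by norm_num
  rcases hr0 with rfl | rfl <;> rcases hs0 with rfl | rfl <;> rcases hr1 with rfl | rfl <;>
    rcases hs1 with rfl | rfl <;> rcases hr2 with rfl | rfl <;> rcases hs2 with rfl | rfl <;>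
    norm_num at hFF hzK' ⊢ <;>
    rcases hQX with ⟨hx, hQ⟩ | ⟨hx, hQ⟩ | ⟨hx, hQ⟩ <;>
    first
      | linarith
      | (right; left; linarith)
      | (right; left; linarith [hzK' (Or.inl hx)])
      | (right; left; linarith [hzK' (Or.inr hx)])
      | (left; linarith)
      | (left; linarith [hzK' (Or.inl hx)])
      | (left; linarith [hzK' (Or.inr hx)])
      | (right; linarith)
      | (right; linarith [hzK' (Or.inl hx)])
      | (right; linarith [hzK' (Or.inr hx)])
      | (right; right; linarith [hzK' (Or.inl hx)])
      | (right; right; linarith [hzK' (Or.inr hx)])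
      | (left; exact ⟨by linarith [hzK' (Or.inl hx)], hx⟩)
      | (left; exact ⟨by linarith [hzK' (Or.inr hx)], hx⟩)

section Points
variable {n m : ℕ} (e : Fin 3 ⊕ Fin 3 ⊕ Fin m ≃ Fin n)

noncomputable def vr (i : Fin 3) : Fin n := e (Sum.inl i)
noncomputable def vs (i : Fin 3) : Fin n := e (Sum.inr (Sum.inl i))
noncomputable def vx (a : Fin m) : Fin n := e (Sum.inr (Sum.inr a))

noncomputable def dF (i : Fin 3) : Fin n → ℝ := (1 / 2 : ℝ) • (sg (vr e i) - sg (vs e i))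
noncomputable def pF (i : Fin 3) : Fin n → ℝ := (1 / 2 : ℝ) • (sg (vr e i) + sg (vs e i))
noncomputable def xF : Fin n → ℝ := ∑ a, sg (vx e a)
noncomputable def lF (b : Finset (Fin m)) : Fin n → ℝ :=
  (1 - (b.card : ℝ) / 2) • dF e 0 - (1 / 2 : ℝ) • ∑ a ∈ b, sg (vx e a)

/-- the points -/
noncomputable def pt (b : Finset (Fin m)) : KEdge n → ℝ :=
  formPt (lF e b) (lF e b)
  - ((m : ℝ) ^ 2 + 10) • formPt (xF e) (pF e 0 + pF e 1 + pF e 2)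
  + (100 + 10 * (((m : ℝ) ^ 2 + 10) * m) + 10 * (m : ℝ) ^ 2) •
    (formPt (dF e 0) (dF e 0) + formPt (dF e 1) (dF e 1) + formPt (dF e 2) (dF e 2))
  - (5 / 6 - ((m : ℝ) ^ 2 + 10) * m / 2) •
    (formPt (pF e 0) (pF e 1) + formPt (pF e 0) (pF e 2) + formPt (pF e 1) (pF e 2))
  - ((100 + 10 * (((m : ℝ) ^ 2 + 10) * m) + 10 * (m : ℝ) ^ 2) + (5 / 6 - ((m : ℝ) ^ 2 + 10) * m / 2)
      + ((m : ℝ) ^ 2 + 10) * m - (b.card : ℝ) ^ 2 / 12) •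
    (formPt (dF e 0) (dF e 1) + formPt (dF e 0) (dF e 2) + formPt (dF e 1) (dF e 2))

lemma cutSum_pt (b : Finset (Fin m)) (S : Finset (Fin n)) :
    cutSum S (pt e b) = FF m b.card (∑ a, spin S (vx e a)) (∑ a ∈ b, spin S (vx e a))
      (spin S (vr e 0)) (spin S (vr e 1)) (spin S (vr e 2))
      (spin S (vs e 0)) (spin S (vs e 1)) (spin S (vs e 2)) := by
  unfold pt FF
  simp only [cutSum_add, cutSum_sub, cutSum_smul, cutSum_formPt, lF, dF, pF, xF, ev_add, ev_sub,
    ev_smul, ev_sum, ev_sg, Finset.sum_const, Finset.card_univ, Fintype.card_fin, nsmul_eq_mul]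
  ring

lemma spin_cases (S : Finset (Fin n)) (v : Fin n) : spin S v = 1 ∨ spin S v = -1 := by
  unfold spin; split_ifs <;> simp

lemma spin_eq_one {S : Finset (Fin n)} {v : Fin n} : spin S v = 1 ↔ v ∈ S := by
  unfold spin; split_ifs with h
  · simp [h]
  · simp only [h, iff_false]; norm_num

lemma spin_eq_neg {S : Finset (Fin n)} {v : Fin n} : spin S v = -1 ↔ v ∉ S := by
  unfold spin; split_ifs with h
  · simp only [h, not_true, iff_false]; norm_num
  · simp [h]

lemma aux_cases (b : Finset (Fin m)) (S : Finset (Fin n)) :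
    ((∀ a, vx e a ∈ S) ∧ (∑ a, spin S (vx e a)) = m ∧ (∑ a ∈ b, spin S (vx e a)) = b.card) ∨
    ((∀ a, vx e a ∉ S) ∧ (∑ a, spin S (vx e a)) = -m ∧ (∑ a ∈ b, spin S (vx e a)) = -b.card) ∨
    (-(m : ℝ) + 2 ≤ (∑ a, spin S (vx e a)) ∧ (∑ a, spin S (vx e a)) ≤ m - 2) := by
  by_cases h1 : ∀ a, vx e a ∈ S
  · left
    have : ∀ a, spin S (vx e a) = 1 := fun a => spin_eq_one.2 (h1 a)
    simp [this, h1]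
  by_cases h2 : ∀ a, vx e a ∉ S
  · right; left
    have : ∀ a, spin S (vx e a) = -1 := fun a => spin_eq_neg.2 (h2 a)
    simp [this, h2]
  right; right
  push Not at h1 h2
  obtain ⟨a1, h1⟩ := h1
  obtain ⟨a2, h2⟩ := h2
  have hb : ∀ a, -1 ≤ spin S (vx e a) ∧ spin S (vx e a) ≤ 1 := by
    intro a
    rcases spin_cases S (vx e a) with h | h <;> rw [h] <;> norm_num
  have e1 := Finset.single_le_sum (f := fun a => 1 - spin S (vx e a)) (s := Finset.univ)
    (fun a _ => by linarith [(hb a).2]) (Finset.mem_univ a1)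
  have e2 := Finset.single_le_sum (f := fun a => spin S (vx e a) + 1) (s := Finset.univ)
    (fun a _ => by linarith [(hb a).1]) (Finset.mem_univ a2)
  simp only [Finset.sum_sub_distrib, Finset.sum_add_distrib, Finset.sum_const, Finset.card_univ,
    Fintype.card_fin, nsmul_eq_mul, mul_one] at e1 e2
  rw [spin_eq_neg.2 h1] at e1
  rw [spin_eq_one.2 h2] at e2
  constructor <;> linarith

lemma pt_class (hm : 1 ≤ m) (b : Finset (Fin m)) (S : Finset (Fin n)) :
    (cutSum S (pt e b) = 0 ∧ (S = ∅ ∨ S = Finset.univ)) ∨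
    10 ≤ cutSum S (pt e b) ∨
    (10 / 3 ≤ cutSum S (pt e b) ∧ ∃ i, vr e i ∈ S ∧ vs e i ∈ S) ∨
    (0 ≤ cutSum S (pt e b) ∧ ∀ i, (vr e i ∈ S ↔ vs e i ∉ S)) := by
  rw [cutSum_pt]
  have hX := aux_cases e b S
  have hc := FF_class m b.card (∑ a, spin S (vx e a)) (∑ a ∈ b, spin S (vx e a))
      (spin S (vr e 0)) (spin S (vr e 1)) (spin S (vr e 2))
      (spin S (vs e 0)) (spin S (vs e 1)) (spin S (vs e 2)) (by exact_mod_cast hm) (by positivity)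
      (by have := Finset.card_le_univ b; simp at this; exact_mod_cast this)
      (spin_cases _ _) (spin_cases _ _) (spin_cases _ _) (spin_cases _ _) (spin_cases _ _)
      (spin_cases _ _) (by
        rcases hX with h | h | h
        · exact Or.inl h.2
        · exact Or.inr (Or.inl h.2)
        · exact Or.inr (Or.inr h))
  have hm' : (1 : ℝ) ≤ m := by exact_mod_cast hm
  rcases hc with ⟨h0, h⟩ | h | ⟨h0, h⟩ | ⟨h0, h1, h2, h3⟩
  · left
    refine ⟨h0, ?_⟩
    simp only [spin_eq_one, spin_eq_neg] at h
    rcases h with ⟨hx, ⟨a0, a1, a2⟩, b0, b1, b2⟩ | ⟨hx, ⟨a0, a1, a2⟩, b0, b1, b2⟩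
    · right
      have hall : ∀ a, vx e a ∈ S := by
        rcases hX with h | h | h
        · exact h.1
        · exfalso; linarith [h.2.1]
        · exfalso; linarith [h.2]
      rw [Finset.eq_univ_iff_forall]
      intro v
      obtain ⟨w, rfl⟩ := e.surjective v
      rcases w with i | i | a
      · fin_cases i
        exacts [a0, a1, a2]
      · fin_cases i
        exacts [b0, b1, b2]
      · exact hall a
    · left
      have hall : ∀ a, vx e a ∉ S := by
        rcases hX with h | h | h
        · exfalso; linarith [h.2.1]
        · exact h.1
        · exfalso; linarith [h.1]
      rw [Finset.eq_empty_iff_forall_notMem]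
      intro v
      obtain ⟨w, rfl⟩ := e.surjective v
      rcases w with i | i | a
      · fin_cases i
        exacts [a0, a1, a2]
      · fin_cases i
        exacts [b0, b1, b2]
      · exact hall a
  · exact Or.inr (Or.inl h)
  · refine Or.inr (Or.inr (Or.inl ⟨h0, ?_⟩))
    simp only [spin_eq_one] at h
    rcases h with h | h | h
    exacts [⟨_, h⟩, ⟨_, h⟩, ⟨_, h⟩]
  · refine Or.inr (Or.inr (Or.inr ⟨h0, ?_⟩))
    have gen : ∀ u v, spin S v = - spin S u → (u ∈ S ↔ v ∉ S) := by
      intro u v h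
      rw [← spin_eq_one, ← spin_eq_neg, h]
      constructor <;> intro h <;> linarith
    intro i
    fin_cases i
    exacts [gen _ _ h1, gen _ _ h2, gen _ _ h3]

lemma pt_mem (hm : 1 ≤ m) (b : Finset (Fin m)) : pt e b ∈ combPolytope n := by
  intro H k T hc
  obtain ⟨hk3, -, hdis, hne, hout⟩ := hc
  have hH : 0 ≤ cutSum H (pt e b) := by
    rcases pt_class e hm b H with h | h | h | h
    · exact h.1.ge
    · linarith
    · linarith [h.1]
    · exact h.1
  have hk3' : (3 : ℝ) ≤ k := by exact_mod_cast hk3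
  have hT : ∀ i, 10 ≤ cutSum (T i) (pt e b) ∨
    (10 / 3 ≤ cutSum (T i) (pt e b) ∧ ∃ j, vr e j ∈ T i ∧ vs e j ∈ T i) ∨
    (0 ≤ cutSum (T i) (pt e b) ∧ ∀ j, (vr e j ∈ T i ↔ vs e j ∉ T i)) := by
    intro i
    rcases pt_class e hm b (T i) with h | h
    · exfalso
      rcases h.2 with h | h
      · obtain ⟨v, hv⟩ := hne i
        rw [h] at hv
        simp at hv
      · obtain ⟨v, hv⟩ := hout
        refine (Finset.mem_sdiff.1 hv).2 (Finset.mem_biUnion.2 ⟨i, Finset.mem_univ i, ?_⟩)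
        rw [h]; exact Finset.mem_univ v
    · exact h
  by_cases hlow : ∃ i, ∀ j, (vr e j ∈ T i ↔ vs e j ∉ T i)
  · obtain ⟨i0, hi0⟩ := hlow
    set L : Finset (Fin k) := Finset.univ.filter (fun i => ∀ j, (vr e j ∈ T i ↔ vs e j ∉ T i))
    have hLm : ∀ i, i ∈ L ↔ ∀ j, (vr e j ∈ T i ↔ vs e j ∉ T i) := fun i =>
      Finset.mem_filter.trans (by simp)
    clear_value L
    have hL : L.card ≤ 2 := by
      have : L.card ≤ (Finset.univ : Finset Bool).card := by
        refine Finset.card_le_card_of_injOn (fun i => decide (vr e 0 ∈ T i))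
          (fun _ _ => Finset.mem_coe.2 (Finset.mem_univ _)) ?_
        intro i hi i' hi' h
        simp only [decide_eq_decide] at h
        by_contra hne'
        have hd := Finset.disjoint_left.1 (hdis i i' hne')
        have h1 := (hLm i).1 hi 0
        have h2 := (hLm i').1 hi' 0
        by_cases hh : vr e 0 ∈ T i
        · exact hd hh (h.1 hh)
        · have h3 : vs e 0 ∈ T i := by
            by_contra h4; exact hh (h1.2 h4)
          have h5 : vs e 0 ∈ T i' := by
            by_contra h4; exact hh (h.2 (h2.2 h4))
          exact hd h3 h5
      simpa using this
    have hb : ∀ i, (10 : ℝ) - (if i ∈ L then 10 else 0) ≤ cutSum (T i) (pt e b) := by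
      intro i
      by_cases hi : i ∈ L
      · simp only [hi, if_true]
        rcases hT i with h | h | h
        · linarith
        · linarith [h.1]
        · linarith [h.1]
      · simp only [hi, if_false, sub_zero]
        rcases hT i with h | ⟨-, j, h1, h2⟩ | h
        · exact h
        · exfalso
          have hne' : i ≠ i0 := by
            rintro rfl; exact hi ((hLm i).2 hi0)
          have hd := Finset.disjoint_left.1 (hdis i i0 hne')
          exact hd h1 ((hi0 j).2 (hd h2))
        · exact absurd ((hLm i).2 h.2) hi
    have hs := Finset.sum_le_sum (s := Finset.univ) (fun i _ => hb i)
    rw [Finset.sum_sub_distrib, Finset.sum_ite_mem] at hs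
    simp only [Finset.univ_inter, Finset.sum_const, Finset.card_univ, Fintype.card_fin,
      nsmul_eq_mul] at hs
    have hL' : (L.card : ℝ) ≤ 2 := by exact_mod_cast hL
    linarith
  · push Not at hlow
    have hb : ∀ i, (10 / 3 : ℝ) ≤ cutSum (T i) (pt e b) := by
      intro i
      rcases hT i with h | h | h
      · linarith
      · exact h.1
      · obtain ⟨j, hj⟩ := hlow i
        have := h.2 j
        tauto
    have hs := Finset.sum_le_sum (s := Finset.univ) (fun i _ => hb i)
    simp only [Finset.sum_const, Finset.card_univ, Fintype.card_fin, nsmul_eq_mul] at hs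
    linarith

noncomputable def Hd (a : Finset (Fin m)) : Finset (Fin n) :=
  Finset.univ.filter fun v => Sum.elim (fun _ => True)
    (Sum.elim (fun _ => False) (fun c => c ∈ a)) (e.symm v)

noncomputable def Tth (i : Fin 3) : Finset (Fin n) := {vr e i, vs e i}

lemma mem_Hd (a : Finset (Fin m)) (v : Fin n) : v ∈ Hd e a ↔ Sum.elim (fun _ => True)
    (Sum.elim (fun _ => False) (fun c => c ∈ a)) (e.symm v) :=
  Finset.mem_filter.trans (by simp)

lemma mem_Tth (i : Fin 3) (v : Fin n) : v ∈ Tth e i ↔ v = vr e i ∨ v = vs e i := by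
  simp [Tth]

lemma Hd_r (a : Finset (Fin m)) (i) : vr e i ∈ Hd e a := by simp [mem_Hd, vr]
lemma Hd_s (a : Finset (Fin m)) (i) : vs e i ∉ Hd e a := by simp [mem_Hd, vs]
lemma Hd_x (a : Finset (Fin m)) (c) : vx e c ∈ Hd e a ↔ c ∈ a := by simp [mem_Hd, vx]
lemma Tth_r (i j) : vr e j ∈ Tth e i ↔ j = i := by simp [mem_Tth, vr, vs]
lemma Tth_s (i j) : vs e j ∈ Tth e i ↔ j = i := by simp [mem_Tth, vr, vs]
lemma Tth_x (i c) : vx e c ∉ Tth e i := by simp [mem_Tth, vr, vs, vx]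

lemma isComb_Hd (a : Finset (Fin m)) (ha : a.Nonempty) : IsComb (Hd e a) (Tth e) := by
  refine ⟨le_rfl, by decide, ?_, ?_, ?_⟩
  · intro i j hij
    rw [Finset.disjoint_left]
    intro v hv hv'
    rcases (mem_Tth e i v).1 hv with rfl | rfl
    · exact hij ((Tth_r e _ _).1 hv')
    · exact hij ((Tth_s e _ _).1 hv')
  · intro i
    exact ⟨vr e i, Finset.mem_inter.2 ⟨Hd_r e a i, (Tth_r e _ _).2 rfl⟩⟩
  · obtain ⟨c, hc⟩ := ha
    refine ⟨vx e c, Finset.mem_sdiff.2 ⟨(Hd_x e a c).2 hc, ?_⟩⟩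
    intro h
    obtain ⟨i, -, hi⟩ := Finset.mem_biUnion.1 h
    exact Tth_x e i c hi

lemma cut_Tth (b : Finset (Fin m)) (i : Fin 3) : cutSum (Tth e i) (pt e b) = 10 / 3 := by
  rw [cutSum_pt]
  have hx : ∀ c, spin (Tth e i) (vx e c) = -1 := fun c => spin_eq_neg.2 (Tth_x e i c)
  have hr : ∀ j, spin (Tth e i) (vr e j) = if j = i then 1 else -1 := by
    intro j; simp [spin, Tth_r]
  have hs : ∀ j, spin (Tth e i) (vs e j) = if j = i then 1 else -1 := by
    intro j; simp [spin, Tth_s]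
  simp only [hx, hr, hs]
  unfold FF
  fin_cases i <;> simp <;> ring

lemma cut_Hd (a b : Finset (Fin m)) :
    cutSum (Hd e a) (pt e b) = (1 - ((a ∩ b).card : ℝ)) ^ 2 := by
  rw [cutSum_pt]
  have hr : ∀ j, spin (Hd e a) (vr e j) = 1 := fun j => spin_eq_one.2 (Hd_r e a j)
  have hs : ∀ j, spin (Hd e a) (vs e j) = -1 := fun j => spin_eq_neg.2 (Hd_s e a j)
  have hx : ∑ c ∈ b, spin (Hd e a) (vx e c) = 2 * ((a ∩ b).card : ℝ) - b.card := by
    have : ∀ c, spin (Hd e a) (vx e c) = 2 * (if c ∈ a then 1 else 0) - 1 := by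
      intro c
      simp only [spin, Hd_x]
      split_ifs <;> norm_num
    simp only [this, Finset.sum_sub_distrib, ← Finset.mul_sum]
    rw [Finset.sum_ite_mem, Finset.inter_comm b a]
    simp
  rw [hx]
  simp only [hr, hs]
  unfold FF
  ring

end Points

lemma main_bound {n m : ℕ} (hm : 1 ≤ m) (e : Fin 3 ⊕ Fin 3 ⊕ Fin m ≃ Fin n) (k d : ℕ)
    (A : Matrix (Fin k) (Fin d) ℝ) (c : Fin k → ℝ) (π : (Fin d → ℝ) →ₗ[ℝ] (KEdge n → ℝ))
    (hπ : π '' {x | A.mulVec x ≤ c} = combPolytope n) : 3 ^ m ≤ (k + 1) * 2 ^ m := by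
  have hl : ∀ b : Finset (Fin m), ∃ y, A.mulVec y ≤ c ∧ π y = pt e b := by
    intro b
    have := pt_mem e hm b
    rw [← hπ] at this
    exact this
  choose y hy hyp using hl
  let ψ : Finset (Fin m) → (Fin d → ℝ) →ₗ[ℝ] ℝ := fun a =>
    (cutL (Hd e a) + ∑ i, cutL (Tth e i)) ∘ₗ π
  have hψ : ∀ a z, ψ a z = cutSum (Hd e a) (π z) + ∑ i, cutSum (Tth e i) (π z) := by
    intro a z
    simp [ψ, cutL]
  have hψy : ∀ a b, ψ a (y b) = 10 + (1 - ((a ∩ b).card : ℝ)) ^ 2 := by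
    intro a b
    rw [hψ, hyp, cut_Hd]
    simp only [cut_Tth]
    simp
    ring
  refine cover_bound (fun i a => ∀ b, ψ a (y b) = 10 → A.mulVec (y b) i = c i)
    (fun i b => A.mulVec (y b) i < c i) ?_ ?_
  · intro i a b h1 h2 h3
    have := h1 b (by rw [hψy, h3]; simp)
    exact h2.ne this
  · intro a b ha hab
    obtain ⟨v, hv⟩ := ha
    refine face_cover A c (ψ a) 10 ?_ y hy {v} ?_ b ?_
    · intro z hz
      have hmem : π z ∈ combPolytope n := by
        rw [← hπ]; exact ⟨z, hz, rfl⟩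
      have := hmem _ _ _ (isComb_Hd e a ⟨v, hv⟩)
      rw [hψ]
      norm_num at this ⊢
      exact this
    · rw [hψy, Finset.inter_singleton_of_mem hv]
      simp
    · rw [hψy, Finset.disjoint_iff_inter_eq_empty.1 hab]
      simp

theorem comb_polytope_xc_exponential :
    ∃ c : ℝ, 0 < c ∧ ∃ N : ℕ, ∀ n : ℕ, N ≤ n →
      (2 : ℝ) ^ (c * n) ≤ (xc (combPolytope n) : ℝ) := by
  refine ⟨1 / 4, by norm_num, 16, fun n hn => ?_⟩
  obtain ⟨m, rfl⟩ : ∃ m, n = 6 + m := ⟨n - 6, by omega⟩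
  have hcard : Fintype.card (Fin 3 ⊕ Fin 3 ⊕ Fin m) = 6 + m := by simp; omega
  obtain ⟨d, A, c, π, hπ⟩ := Nat.sInf_mem (xc_set_nonempty (6 + m))
  have hb := main_bound (by omega) (Fintype.equivFinOfCardEq hcard) _ d A c π hπ
  change 3 ^ m ≤ (xc (combPolytope (6 + m)) + 1) * 2 ^ m at hb
  generalize xc (combPolytope (6 + m)) = k at hb
  clear hπ
  have hb' : (3 : ℝ) ^ m ≤ (k + 1) * 2 ^ m := by exact_mod_cast hb
  have h1 : (3 / 2 : ℝ) ^ m ≤ k + 1 := by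
    rw [div_pow, div_le_iff₀ (by positivity)]
    exact hb'
  have h2 : (2 : ℝ) ^ ((m : ℝ) / 2) ≤ (3 / 2 : ℝ) ^ m := by
    have h3 : (2 : ℝ) ^ ((1 : ℝ) / 2) ≤ 3 / 2 := by
      rw [← Real.sqrt_eq_rpow]
      rw [Real.sqrt_le_left (by norm_num)]
      norm_num
    calc (2 : ℝ) ^ ((m : ℝ) / 2) = ((2 : ℝ) ^ ((1 : ℝ) / 2)) ^ m := by
          rw [← Real.rpow_natCast, ← Real.rpow_mul (by norm_num)]
          congr 1; ring
      _ ≤ _ := pow_le_pow_left₀ (by positivity) h3 m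
  have hm : (10 : ℝ) ≤ m := by
    have : 10 ≤ m := by omega
    exact_mod_cast this
  have h4 : (2 : ℝ) ^ (1 / 4 * ((6 + m : ℕ) : ℝ)) * 2 ≤ (2 : ℝ) ^ ((m : ℝ) / 2) := by
    calc (2 : ℝ) ^ (1 / 4 * ((6 + m : ℕ) : ℝ)) * 2
        = (2 : ℝ) ^ (1 / 4 * ((6 + m : ℕ) : ℝ) + 1) := by
          rw [Real.rpow_add (by norm_num), Real.rpow_one]
      _ ≤ _ := by
          apply Real.rpow_le_rpow_of_exponent_le (by norm_num)
          push_cast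
          linarith
  have h5 : (1 : ℝ) ≤ (2 : ℝ) ^ (1 / 4 * ((6 + m : ℕ) : ℝ)) :=
    Real.one_le_rpow (by norm_num) (by positivity)
  linarith
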